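/- For any real numbers c₁, c₂, c₃ and any p ∈ [0,1] with q := 1 − p, the RSP-fidelity of the Bell-diagonal state ρ(c₁,c₂,c₃) after the symmetric local amplitude damping channel is F_RSP(Φ_p(ρ(c₁,c₂,c₃))) = ½[ q²(c₁² + c₂²) + (c₃ q² + p²)² − max{ (q c₁)², (q c₂)², (c₃ q² + p²)² } ]. -/

import Mathlib

open Matrix Kronecker ComplexOrder

noncomputable section

def pauli : Fin 3 → Matrix (Fin 2) (Fin 2) ℂ :=
  ![!![0, 1; 1, 0], !![0, -Complex.I; Complex.I, 0], !![1, 0; 0, -1]]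

def corr (ρ : Matrix (Fin 2 × Fin 2) (Fin 2 × Fin 2) ℂ) : Matrix (Fin 3) (Fin 3) ℝ :=
  Matrix.of fun k l => (Matrix.trace (ρ * (pauli k ⊗ₖ pauli l))).re

def lambdaMax (M : Matrix (Fin 3) (Fin 3) ℝ) : ℝ :=
  sSup {x : ℝ | ∃ v : Fin 3 → ℝ, v ≠ 0 ∧ M.mulVec v = x • v}

def Frsp (ρ : Matrix (Fin 2 × Fin 2) (Fin 2 × Fin 2) ℂ) : ℝ :=
  (1 / 2) * (Matrix.trace ((corr ρ)ᵀ * corr ρ) - lambdaMax ((corr ρ)ᵀ * corr ρ))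

def damp (p : ℝ) : Fin 2 → Matrix (Fin 2) (Fin 2) ℂ :=
  ![!![1, 0; 0, (Real.sqrt (1 - p) : ℂ)], !![0, (Real.sqrt p : ℂ); 0, 0]]

def Phi (p : ℝ) (ρ : Matrix (Fin 2 × Fin 2) (Fin 2 × Fin 2) ℂ) :
    Matrix (Fin 2 × Fin 2) (Fin 2 × Fin 2) ℂ :=
  ∑ i : Fin 2, ∑ j : Fin 2, (damp p i ⊗ₖ damp p j) * ρ * (damp p i ⊗ₖ damp p j)ᴴ

def bellDiag (c₁ c₂ c₃ : ℝ) : Matrix (Fin 2 × Fin 2) (Fin 2 × Fin 2) ℂ :=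
  (1 / 4 : ℂ) • (1 + (c₁ : ℂ) • (pauli 0 ⊗ₖ pauli 0) + (c₂ : ℂ) • (pauli 1 ⊗ₖ pauli 1)
    + (c₃ : ℂ) • (pauli 2 ⊗ₖ pauli 2))

def bloch (ρ : Matrix (Fin 2 × Fin 2) (Fin 2 × Fin 2) ℂ) : Fin 3 → ℝ :=
  fun k => (Matrix.trace (ρ * (pauli k ⊗ₖ (1 : Matrix (Fin 2) (Fin 2) ℂ)))).re

def Dg (ρ : Matrix (Fin 2 × Fin 2) (Fin 2 × Fin 2) ℂ) : ℝ :=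
  (1 / 2) * ((∑ k, bloch ρ k ^ 2) + Matrix.trace (corr ρ * (corr ρ)ᵀ)
    - lambdaMax (Matrix.vecMulVec (bloch ρ) (bloch ρ) + corr ρ * (corr ρ)ᵀ))

/-- The single-qubit amplitude damping channel. -/
def amplitudeDamping (p : ℝ) (A : Matrix (Fin 2) (Fin 2) ℂ) : Matrix (Fin 2) (Fin 2) ℂ :=
  ∑ i : Fin 2, damp p i * A * (damp p i)ᴴ

lemma Phi_kronecker (p : ℝ) (A B : Matrix (Fin 2) (Fin 2) ℂ) :
    Phi p (A ⊗ₖ B) = amplitudeDamping p A ⊗ₖ amplitudeDamping p B := by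
  simp only [Phi, amplitudeDamping, conjTranspose_kronecker, ← mul_kronecker_mul,
    Fin.sum_univ_two, add_kronecker, kronecker_add]
  abel

lemma Phi_add (p : ℝ) (ρ τ : Matrix (Fin 2 × Fin 2) (Fin 2 × Fin 2) ℂ) :
    Phi p (ρ + τ) = Phi p ρ + Phi p τ := by
  simp only [Phi, mul_add, add_mul, Finset.sum_add_distrib]

lemma Phi_smul (p : ℝ) (c : ℂ) (ρ : Matrix (Fin 2 × Fin 2) (Fin 2 × Fin 2) ℂ) :
    Phi p (c • ρ) = c • Phi p ρ := by
  simp only [Phi, mul_smul_comm, smul_mul_assoc, Finset.smul_sum]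

lemma ofReal_sqrt_mul_self {x : ℝ} (hx : 0 ≤ x) :
    (Real.sqrt x : ℂ) * (Real.sqrt x : ℂ) = x := by
  rw [← Complex.ofReal_mul, Real.mul_self_sqrt hx]

lemma amplitudeDamping_of {p : ℝ} (hp : p ∈ Set.Icc (0 : ℝ) 1) (a b c d : ℂ) :
    amplitudeDamping p !![a, b; c, d] =
      !![a + p * d, Real.sqrt (1 - p) * b; Real.sqrt (1 - p) * c, (1 - p) * d] := by
  have h₀ := ofReal_sqrt_mul_self hp.1
  have h₁ := ofReal_sqrt_mul_self (sub_nonneg.2 hp.2)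
  rw [Complex.ofReal_sub, Complex.ofReal_one] at h₁
  ext i j
  fin_cases i <;> fin_cases j <;>
    simp [amplitudeDamping, damp, Matrix.vecMul, dotProduct, Fin.sum_univ_two]
  · linear_combination d * h₀
  · ring
  · linear_combination d * h₁

lemma amplitudeDamping_one {p : ℝ} (hp : p ∈ Set.Icc (0 : ℝ) 1) :
    amplitudeDamping p 1 = 1 + (p : ℂ) • pauli 2 := by
  rw [one_fin_two, amplitudeDamping_of hp]
  simp [pauli, sub_eq_add_neg]

lemma amplitudeDamping_pauli_zero {p : ℝ} (hp : p ∈ Set.Icc (0 : ℝ) 1) :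
    amplitudeDamping p (pauli 0) = (Real.sqrt (1 - p) : ℂ) • pauli 0 := by
  simp [pauli, amplitudeDamping_of hp]

lemma amplitudeDamping_pauli_one {p : ℝ} (hp : p ∈ Set.Icc (0 : ℝ) 1) :
    amplitudeDamping p (pauli 1) = (Real.sqrt (1 - p) : ℂ) • pauli 1 := by
  simp [pauli, amplitudeDamping_of hp]

lemma amplitudeDamping_pauli_two {p : ℝ} (hp : p ∈ Set.Icc (0 : ℝ) 1) :
    amplitudeDamping p (pauli 2) = ((1 - p : ℝ) : ℂ) • pauli 2 := by
  simp [pauli, amplitudeDamping_of hp, sub_eq_add_neg]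

lemma trace_pauli (k : Fin 3) : (pauli k).trace = 0 := by
  fin_cases k <;> simp [pauli, Matrix.trace, Fin.sum_univ_two]

lemma trace_pauli_mul_pauli (k l : Fin 3) :
    (pauli k * pauli l).trace = if k = l then 2 else 0 := by
  fin_cases k <;> fin_cases l <;>
    simp [pauli, Matrix.trace, Fin.sum_univ_two] <;> norm_num

lemma Phi_bellDiag (c₁ c₂ c₃ : ℝ) {p : ℝ} (hp : p ∈ Set.Icc (0 : ℝ) 1) :
    Phi p (bellDiag c₁ c₂ c₃) =
      (1 / 4 : ℂ) • ((1 + (p : ℂ) • pauli 2) ⊗ₖ (1 + (p : ℂ) • pauli 2)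
        + (c₁ * (1 - p) : ℂ) • (pauli 0 ⊗ₖ pauli 0)
        + (c₂ * (1 - p) : ℂ) • (pauli 1 ⊗ₖ pauli 1)
        + (c₃ * ((1 - p) * (1 - p)) : ℂ) • (pauli 2 ⊗ₖ pauli 2)) := by
  have h := ofReal_sqrt_mul_self (sub_nonneg.2 hp.2)
  rw [bellDiag, ← one_kronecker_one]
  simp only [Phi_smul, Phi_add, Phi_kronecker, amplitudeDamping_one hp,
    amplitudeDamping_pauli_zero hp, amplitudeDamping_pauli_one hp, amplitudeDamping_pauli_two hp,
    smul_kronecker _ (pauli _) (pauli _), kronecker_smul, smul_smul, h]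
  push_cast
  rfl

lemma corr_Phi_bellDiag (c₁ c₂ c₃ : ℝ) {p : ℝ} (hp : p ∈ Set.Icc (0 : ℝ) 1) :
    corr (Phi p (bellDiag c₁ c₂ c₃)) =
      diagonal ![(1 - p) * c₁, (1 - p) * c₂, c₃ * (1 - p) ^ 2 + p ^ 2] := by
  ext k l
  rw [Phi_bellDiag c₁ c₂ c₃ hp]
  simp only [corr, Matrix.of_apply, smul_mul_assoc, add_mul, ← mul_kronecker_mul, trace_smul,
    trace_add, trace_kronecker, one_mul, trace_pauli, trace_pauli_mul_pauli]
  norm_cast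
  fin_cases k <;> fin_cases l <;> simp <;> norm_cast <;> ring

lemma lambdaMax_diagonal (d : Fin 3 → ℝ) :
    lambdaMax (diagonal d) = max (max (d 0) (d 1)) (d 2) := by
  have hset : {x : ℝ | ∃ v : Fin 3 → ℝ, v ≠ 0 ∧ (diagonal d).mulVec v = x • v} =
      Set.range d := by
    ext x
    constructor
    · rintro ⟨v, hv, h⟩
      obtain ⟨i, hi⟩ := Function.ne_iff.1 hv
      refine ⟨i, mul_right_cancel₀ hi ?_⟩
      simpa [mulVec_diagonal] using congrFun h i
    · rintro ⟨i, rfl⟩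
      exact ⟨Pi.single i 1, by simp, by simp [← Pi.single_smul]⟩
  rw [lambdaMax, hset]
  refine IsGreatest.csSup_eq ⟨?_, ?_⟩
  · rcases max_choice (max (d 0) (d 1)) (d 2) with h | h <;> rw [h]
    · rcases max_choice (d 0) (d 1) with h | h <;> rw [h] <;> exact Set.mem_range_self _
    · exact Set.mem_range_self _
  · rintro _ ⟨i, rfl⟩
    fin_cases i <;> simp

/-- RSP-fidelity of a Bell-diagonal state after the symmetric local amplitude
damping channel. -/
theorem frsp_bellDiag_after_damping
    (c₁ c₂ c₃ : ℝ) (p : ℝ) (hp : p ∈ Set.Icc (0 : ℝ) 1) :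
    Frsp (Phi p (bellDiag c₁ c₂ c₃)) =
      (1 / 2) * ((1 - p) ^ 2 * (c₁ ^ 2 + c₂ ^ 2) + (c₃ * (1 - p) ^ 2 + p ^ 2) ^ 2
        - max (max (((1 - p) * c₁) ^ 2) (((1 - p) * c₂) ^ 2))
            ((c₃ * (1 - p) ^ 2 + p ^ 2) ^ 2)) := by
  rw [Frsp, corr_Phi_bellDiag c₁ c₂ c₃ hp, diagonal_transpose, diagonal_mul_diagonal,
    lambdaMax_diagonal, trace_diagonal, Fin.sum_univ_three]
  simp only [Matrix.cons_val, ← pow_two]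
  ring

end
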